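/- arXiv:1408.2854 — 2 statements merged into one kernel-verified Lean document; each statement's English description precedes it below -/
import Mathlib

section
/- Minimizing f(b, c) = (1/S)||b||² + (1/S)||F* b||² + ||G* b + D* c - a||² jointly over b and c, where G D* = 0 (the columns of G* are orthogonal to rows of D) and DD* is invertible, gives optimal values b* = a* G* ((1/S)(I + FF*) + GG*)⁻¹ and c* = a* D*(DD*)⁻¹, and minimum value a* U a with U = I - G*((1/S)(I + FF*) + GG*)⁻¹ G - D*(DD*)⁻¹ D. -/
open Matrix

noncomputable def nsq {L : ℕ} (v : Fin L → ℂ) : ℝ := ∑ i, ‖v i‖ ^ 2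

/-- The objective f(b, c) = (1/S)‖b‖² + (1/S)‖F* b‖² + ‖G* b + D* c - a‖². -/
noncomputable def f8 {m k L : ℕ} (S : ℝ) (F : Matrix (Fin m) (Fin m) ℂ)
    (G : Matrix (Fin m) (Fin L) ℂ) (D : Matrix (Fin k) (Fin L) ℂ)
    (a : Fin L → ℂ) (b : Fin m → ℂ) (c : Fin k → ℂ) : ℝ :=
  (1 / S) * nsq b + (1 / S) * nsq (Fᴴ *ᵥ b) + nsq (Gᴴ *ᵥ b + Dᴴ *ᵥ c - a)

theorem nsq_nonneg {n : ℕ} (v : Fin n → ℂ) : 0 ≤ nsq v :=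
  Finset.sum_nonneg fun _ _ => sq_nonneg _

theorem nsq_eq_re_dotProduct {n : ℕ} (v : Fin n → ℂ) : nsq v = (star v ⬝ᵥ v).re := by
  simp only [nsq, dotProduct, Complex.re_sum, Pi.star_apply]
  refine Finset.sum_congr rfl fun i _ => ?_
  rw [Complex.sq_norm, Complex.normSq_apply]
  simp

theorem nsq_add {n : ℕ} (x y : Fin n → ℂ) :
    nsq (x + y) = nsq x + nsq y + 2 * (star x ⬝ᵥ y).re := by
  have h : (star y ⬝ᵥ x).re = (star x ⬝ᵥ y).re := by
    rw [← Complex.conj_re (star x ⬝ᵥ y), starRingEnd_apply, star_dotProduct]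
  simp only [nsq_eq_re_dotProduct, star_add, add_dotProduct, dotProduct_add, Complex.add_re, h]
  ring

theorem star_conjTranspose_mulVec_dotProduct {m n : ℕ} (A : Matrix (Fin m) (Fin n) ℂ)
    (p : Fin m → ℂ) (v : Fin n → ℂ) : star (Aᴴ *ᵥ p) ⬝ᵥ v = star p ⬝ᵥ (A *ᵥ v) := by
  rw [star_mulVec, conjTranspose_conjTranspose, dotProduct_mulVec]

open scoped ComplexOrder in
theorem isUnit_det_smul_one_add_add {m L : ℕ} {t : ℝ} (ht : 0 < t)
    (F : Matrix (Fin m) (Fin m) ℂ) (G : Matrix (Fin m) (Fin L) ℂ) :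
    IsUnit ((t : ℂ) • (1 + F * Fᴴ) + G * Gᴴ).det := by
  have h : ((t : ℂ) • (1 + F * Fᴴ) + G * Gᴴ).PosDef :=
    ((PosDef.one.add_posSemidef (posSemidef_self_mul_conjTranspose F)).smul
      (by exact_mod_cast ht : (0 : ℂ) < t)).add_posSemidef (posSemidef_self_mul_conjTranspose G)
  exact (isUnit_iff_isUnit_det _).mp h.isUnit

/-- The first variation of the objective in the direction `(p, q)` vanishes at a point solving
the normal equations. -/
theorem first_variation_eq_zero {m k L : ℕ} (t : ℝ)
    (F : Matrix (Fin m) (Fin m) ℂ) (G : Matrix (Fin m) (Fin L) ℂ)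
    (D : Matrix (Fin k) (Fin L) ℂ) (hGD : G * Dᴴ = 0) (a : Fin L → ℂ)
    (b : Fin m → ℂ) (c : Fin k → ℂ)
    (hb : ((t : ℂ) • (1 + F * Fᴴ) + G * Gᴴ) *ᵥ b = G *ᵥ a)
    (hc : (D * Dᴴ) *ᵥ c = D *ᵥ a) (p : Fin m → ℂ) (q : Fin k → ℂ) :
    t * (star p ⬝ᵥ b).re + t * (star (Fᴴ *ᵥ p) ⬝ᵥ (Fᴴ *ᵥ b)).re
      + (star (Gᴴ *ᵥ p + Dᴴ *ᵥ q) ⬝ᵥ (Gᴴ *ᵥ b + Dᴴ *ᵥ c - a)).re = 0 := by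
  have hDG : D * Gᴴ = 0 := by
    simpa using congrArg conjTranspose hGD
  have hD : D *ᵥ (Gᴴ *ᵥ b + Dᴴ *ᵥ c - a) = 0 := by
    simp [mulVec_sub, mulVec_add, hDG, hc]
  have hG : G *ᵥ (Gᴴ *ᵥ b + Dᴴ *ᵥ c - a) = -((t : ℂ) • (b + F *ᵥ (Fᴴ *ᵥ b))) := by
    rw [mulVec_sub, mulVec_add, ← hb]
    simp [hGD, add_mulVec, smul_mulVec]
  rw [star_add, add_dotProduct]
  simp only [star_conjTranspose_mulVec_dotProduct, hD, hG]
  simp [dotProduct_add]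

/-- Theorem 3 (full): with G D* = 0 and DD* invertible, the joint minimizers are
b = ((1/S)(I + FF*) + GG*)⁻¹ G a and c = (DD*)⁻¹ D a, and the minimum value is
a* U a with U = I - G*((1/S)(I + FF*) + GG*)⁻¹G - D*(DD*)⁻¹D. -/
theorem stmt8 {m k L : ℕ} {S : ℝ} (hS : 0 < S)
    (F : Matrix (Fin m) (Fin m) ℂ) (G : Matrix (Fin m) (Fin L) ℂ)
    (D : Matrix (Fin k) (Fin L) ℂ) [Invertible (D * Dᴴ)]
    (hGD : G * Dᴴ = 0) (a : Fin L → ℂ)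
    (M : Matrix (Fin m) (Fin m) ℂ)
    (hM : M = (((1 / S : ℝ)) : ℂ) • (1 + F * Fᴴ) + G * Gᴴ)
    (bopt : Fin m → ℂ) (hb : bopt = M⁻¹ *ᵥ (G *ᵥ a))
    (copt : Fin k → ℂ) (hc : copt = (D * Dᴴ)⁻¹ *ᵥ (D *ᵥ a))
    (U : Matrix (Fin L) (Fin L) ℂ)
    (hU : U = 1 - Gᴴ * M⁻¹ * G - Dᴴ * (D * Dᴴ)⁻¹ * D) :
    (∀ (b : Fin m → ℂ) (c : Fin k → ℂ), f8 S F G D a bopt copt ≤ f8 S F G D a b c) ∧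
      f8 S F G D a bopt copt = (star a ⬝ᵥ (U *ᵥ a)).re := by
  have hMb : M *ᵥ bopt = G *ᵥ a := by
    have hdet : IsUnit M.det := hM ▸ isUnit_det_smul_one_add_add (one_div_pos.mpr hS) F G
    rw [hb, mulVec_mulVec, mul_nonsing_inv _ hdet, one_mulVec]
  have hDc : (D * Dᴴ) *ᵥ copt = D *ᵥ a := by
    rw [hc, mulVec_mulVec, mul_inv_of_invertible, one_mulVec]
  have key := first_variation_eq_zero (1 / S) F G D hGD a bopt copt (hM ▸ hMb) hDc
  refine ⟨fun b c => ?_, ?_⟩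
  · obtain ⟨p, rfl⟩ : ∃ p, b = p + bopt := ⟨b - bopt, by simp⟩
    obtain ⟨q, rfl⟩ : ∃ q, c = q + copt := ⟨c - copt, by simp⟩
    have hr : Gᴴ *ᵥ (p + bopt) + Dᴴ *ᵥ (q + copt) - a
        = (Gᴴ *ᵥ p + Dᴴ *ᵥ q) + (Gᴴ *ᵥ bopt + Dᴴ *ᵥ copt - a) := by
      rw [mulVec_add, mulVec_add]; abel
    have hS' : 0 ≤ 1 / S := (one_div_pos.mpr hS).le
    have h₁ := mul_nonneg hS' (nsq_nonneg p)
    have h₂ := mul_nonneg hS' (nsq_nonneg (Fᴴ *ᵥ p))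
    have h₃ := nsq_nonneg (Gᴴ *ᵥ p + Dᴴ *ᵥ q)
    have h₄ := key p q
    unfold f8
    rw [hr, mulVec_add Fᴴ, nsq_add p, nsq_add (Fᴴ *ᵥ p), nsq_add (Gᴴ *ᵥ p + Dᴴ *ᵥ q)]
    linarith
  · have hUa : U *ᵥ a = -(Gᴴ *ᵥ bopt + Dᴴ *ᵥ copt - a) := by
      rw [hU, hb, hc]
      simp only [sub_mulVec, one_mulVec, mulVec_mulVec, Matrix.mul_assoc]
      abel
    have h := key bopt copt
    unfold f8
    rw [hUa]
    simp only [nsq_eq_re_dotProduct, star_sub, sub_dotProduct, dotProduct_neg, Complex.sub_re,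
      Complex.neg_re]
    linarith
end

section
/- The matrix U = I - G*((1/S)(I + FF*) + GG*)⁻¹G - D*(DD*)⁻¹D is Hermitian positive semidefinite, assuming G D* = 0, S > 0, and DD* invertible. -/
open Matrix
open scoped ComplexOrder

/-- For a regularized Gram matrix `P + G * Gᴴ`, the defect of idempotence of
`Gᴴ * (P + G * Gᴴ)⁻¹ * G`. -/
lemma conjTranspose_mul_inv_mul_sub_sq {m n : Type*} [Fintype m] [DecidableEq m] [Fintype n]
    {P : Matrix m m ℂ} {G : Matrix m n ℂ} (hA : IsUnit (P + G * Gᴴ).det) :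
    Gᴴ * (P + G * Gᴴ)⁻¹ * G - Gᴴ * (P + G * Gᴴ)⁻¹ * G * (Gᴴ * (P + G * Gᴴ)⁻¹ * G)
      = Gᴴ * (P + G * Gᴴ)⁻¹ * P * ((P + G * Gᴴ)⁻¹ * G) := by
  set M := (P + G * Gᴴ)⁻¹ with hM
  have h : M = M * P * M + M * (G * Gᴴ) * M := by
    rw [← add_mul, ← mul_add, hM, nonsing_inv_mul _ hA, one_mul]
  rw [sub_eq_iff_eq_add]
  nth_rewrite 1 [h]
  simp only [Matrix.mul_add, Matrix.add_mul, Matrix.mul_assoc]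

lemma posSemidef_one_sub_sub {m k n : Type*} [Fintype m] [DecidableEq m] [Fintype k]
    [DecidableEq k] [Fintype n] [DecidableEq n]
    {P : Matrix m m ℂ} (hP : P.PosDef) (G : Matrix m n ℂ) (D : Matrix k n ℂ)
    (hD : IsUnit (D * Dᴴ).det) (hGD : G * Dᴴ = 0) :
    (1 - Gᴴ * (P + G * Gᴴ)⁻¹ * G - Dᴴ * (D * Dᴴ)⁻¹ * D).PosSemidef := by
  have hApos : (P + G * Gᴴ).PosDef := hP.add_posSemidef (posSemidef_self_mul_conjTranspose G)
  have hA : IsUnit (P + G * Gᴴ).det := (isUnit_iff_isUnit_det _).1 hApos.isUnit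
  have hM : (P + G * Gᴴ)⁻¹ᴴ = (P + G * Gᴴ)⁻¹ := hApos.isHermitian.inv
  have hN : (D * Dᴴ)⁻¹ᴴ = (D * Dᴴ)⁻¹ := (isHermitian_mul_conjTranspose_self D).inv
  have hdefect := conjTranspose_mul_inv_mul_sub_sq hA
  set X := Gᴴ * (P + G * Gᴴ)⁻¹ * G with hX
  set Y := Dᴴ * (D * Dᴴ)⁻¹ * D with hY
  have hXh : Xᴴ = X := by simp only [hX, conjTranspose_mul, hM, conjTranspose_conjTranspose,
    Matrix.mul_assoc]
  have hYh : Yᴴ = Y := by simp only [hY, conjTranspose_mul, hN, conjTranspose_conjTranspose,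
    Matrix.mul_assoc]
  have hXY : X * Y = 0 := by
    have : X * Y = Gᴴ * (P + G * Gᴴ)⁻¹ * (G * Dᴴ) * ((D * Dᴴ)⁻¹ * D) := by
      simp only [hX, hY, Matrix.mul_assoc]
    rw [this, hGD, Matrix.mul_zero, Matrix.zero_mul]
  have hYX : Y * X = 0 := by
    rw [← hXh, ← hYh, ← conjTranspose_mul, hXY, conjTranspose_zero]
  have hYY : Y * Y = Y := by
    have : Y * Y = Dᴴ * ((D * Dᴴ)⁻¹ * (D * Dᴴ)) * ((D * Dᴴ)⁻¹ * D) := by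
      simp only [hY, Matrix.mul_assoc]
    rw [this, nonsing_inv_mul _ hD, Matrix.mul_one, hY, Matrix.mul_assoc]
  have key : 1 - X - Y = (1 - X - Y)ᴴ * (1 - X - Y)
      + ((P + G * Gᴴ)⁻¹ * G)ᴴ * P * ((P + G * Gᴴ)⁻¹ * G) := by
    rw [conjTranspose_mul, hM, ← hdefect]
    simp only [conjTranspose_sub, conjTranspose_one, hXh, hYh, mul_sub, sub_mul, one_mul, mul_one,
      hXY, hYX, hYY]
    abel
  rw [key]
  exact (posSemidef_conjTranspose_mul_self _).add (hP.posSemidef.conjTranspose_mul_mul_same _)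

/-- U = I - G*((1/S)(I + FF*) + GG*)⁻¹G - D*(DD*)⁻¹D is Hermitian positive
semidefinite, assuming G D* = 0, S > 0, and DD* invertible. -/
theorem stmt10 {m k L : ℕ} {S : ℝ} (hS : 0 < S)
    (F : Matrix (Fin m) (Fin m) ℂ) (G : Matrix (Fin m) (Fin L) ℂ)
    (D : Matrix (Fin k) (Fin L) ℂ) [Invertible (D * Dᴴ)]
    (hGD : G * Dᴴ = 0)
    (U : Matrix (Fin L) (Fin L) ℂ)
    (hU : U = 1 - Gᴴ * ((((1 / S : ℝ)) : ℂ) • (1 + F * Fᴴ) + G * Gᴴ)⁻¹ * G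
        - Dᴴ * (D * Dᴴ)⁻¹ * D) :
    Uᴴ = U ∧ ∀ a : Fin L → ℂ, 0 ≤ (star a ⬝ᵥ (U *ᵥ a)).re := by
  have hc : (0 : ℂ) < ((1 / S : ℝ) : ℂ) := Complex.zero_lt_real.2 (one_div_pos.2 hS)
  have hP : ((((1 / S : ℝ)) : ℂ) • (1 + F * Fᴴ)).PosDef :=
    (PosDef.one.add_posSemidef (posSemidef_self_mul_conjTranspose F)).smul hc
  have hpsd : U.PosSemidef :=
    hU ▸ posSemidef_one_sub_sub hP G D (isUnit_det_of_invertible _) hGD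
  exact ⟨hpsd.isHermitian, fun a => hpsd.re_dotProduct_nonneg a⟩
end
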